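/- Let f : ℂ² → ℂ be the mixed polynomial f(z₁,z₂) = (1/4)z₁² − (1/4)z̄₁² + z₁z̄₁ − (1+i)(z₁+z₂)(z̄₁+z̄₂). Then S(f) = ∅, i.e., there is no c ∈ ℂ admitting a sequence z_k in the Milnor set M(f) with ‖z_k‖ → ∞ and f(z_k) → c. -/

import Mathlib

open Complex Finset Filter Topology

/-- Coefficients of a mixed polynomial in `n` variables: a finitely supported
function assigning to each pair of multi-indices `(ν, μ)` the coefficient `c_{ν,μ}`. -/
abbrev MixedCoeff (n : ℕ) := ((Fin n → ℕ) × (Fin n → ℕ)) →₀ ℂ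

/-- Evaluation of the mixed polynomial `f(z, z̄) = Σ c_{ν,μ} z^ν z̄^μ`. -/
noncomputable def mixedEval {n : ℕ} (c : MixedCoeff n) (z : Fin n → ℂ) : ℂ :=
  c.sum fun p a => a * (∏ j, z j ^ p.1 j) * ∏ j, (starRingEnd ℂ) (z j) ^ p.2 j

/-- Wirtinger derivative `∂f/∂z_j`. -/
noncomputable def wdz {n : ℕ} (c : MixedCoeff n) (j : Fin n) (z : Fin n → ℂ) : ℂ :=
  c.sum fun p a => a * (p.1 j : ℂ) * z j ^ (p.1 j - 1) *
    (∏ k ∈ Finset.univ.erase j, z k ^ p.1 k) * ∏ k, (starRingEnd ℂ) (z k) ^ p.2 k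

/-- Wirtinger derivative `∂f/∂z̄_j`. -/
noncomputable def wdzbar {n : ℕ} (c : MixedCoeff n) (j : Fin n) (z : Fin n → ℂ) : ℂ :=
  c.sum fun p a => a * (p.2 j : ℂ) * (starRingEnd ℂ) (z j) ^ (p.2 j - 1) *
    (∏ k ∈ Finset.univ.erase j, (starRingEnd ℂ) (z k) ^ p.2 k) * ∏ k, z k ^ p.1 k

/-- The point `ν + μ ∈ ℝⁿ` associated to a monomial `z^ν z̄^μ`. -/
def exptPt {n : ℕ} (p : (Fin n → ℕ) × (Fin n → ℕ)) : Fin n → ℝ := fun j => (p.1 j + p.2 j : ℕ)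

/-- `supp(f) ⊆ ℝⁿ`. -/
def mixedSupp {n : ℕ} (c : MixedCoeff n) : Set (Fin n → ℝ) :=
  {x | ∃ p ∈ c.support, exptPt p = x}

/-- The Newton polyhedron `Γ₀(f)`: convex hull of `{0} ∪ supp(f)`. -/
noncomputable def Gamma0 {n : ℕ} (c : MixedCoeff n) : Set (Fin n → ℝ) :=
  convexHull ℝ (insert 0 (mixedSupp c))

/-- `supp̄(f)`: convex hull of `supp(f) \ {0}`. -/
noncomputable def suppBar {n : ℕ} (c : MixedCoeff n) : Set (Fin n → ℝ) :=
  convexHull ℝ (mixedSupp c \ {0})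

/-- A face (of any dimension) of the Newton boundary at infinity `Γ⁺(f)`:
a face of `Γ₀(f)` not containing the origin. -/
def IsFaceAtInfinity {n : ℕ} (c : MixedCoeff n) (Δ : Set (Fin n → ℝ)) : Prop :=
  IsExtreme ℝ (Gamma0 c) Δ ∧ (0 : Fin n → ℝ) ∉ Δ

open Classical in
/-- The restriction `f_Δ` of `f` to a face `Δ`: keep the monomials with `ν + μ ∈ Δ`. -/
noncomputable def faceRestrict {n : ℕ} (c : MixedCoeff n) (Δ : Set (Fin n → ℝ)) :
    MixedCoeff n :=
  c.filter fun p => exptPt p ∈ Δ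

/-- `Sing f`: the set of mixed singularities, via Oka's characterization:
`conj (df) = λ · d̄f` for some `λ` with `|λ| = 1`. -/
def mixedSing {n : ℕ} (c : MixedCoeff n) : Set (Fin n → ℂ) :=
  {z | ∃ lam : ℂ, ‖lam‖ = 1 ∧
      ∀ j, (starRingEnd ℂ) (wdz c j z) = lam * wdzbar c j z}

/-- `(ℂ*)ⁿ`. -/
def cstarn (n : ℕ) : Set (Fin n → ℂ) := {z | ∀ j, z j ≠ 0}

/-- `f` is Newton strongly non-degenerate: `Sing f_Δ ∩ (ℂ*)ⁿ = ∅` for every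
face `Δ` of `Γ⁺(f)`. -/
def StronglyNonDeg {n : ℕ} (c : MixedCoeff n) : Prop :=
  ∀ Δ : Set (Fin n → ℝ), IsFaceAtInfinity c Δ →
    mixedSing (faceRestrict c Δ) ∩ cstarn n = ∅

/-- `f` is convenient: `supp(f)` meets every coordinate axis. -/
def Convenient {n : ℕ} (c : MixedCoeff n) : Prop :=
  ∀ j : Fin n, ∃ p ∈ c.support, 0 < p.1 j + p.2 j ∧ ∀ k, k ≠ j → p.1 k + p.2 k = 0

/-- `V(f) = f⁻¹(0)`. -/
def Vf {n : ℕ} (c : MixedCoeff n) : Set (Fin n → ℂ) := {z | mixedEval c z = 0}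

/-- `φ = f / |f|` (with junk value `0` on `V(f)`). -/
noncomputable def phiMap {n : ℕ} (c : MixedCoeff n) (z : Fin n → ℂ) : ℂ :=
  mixedEval c z / (‖mixedEval c z‖ : ℝ)

/-- `Sing φ = {z ∉ V(f) : conj(f)·d̄f = f·conj(df)}`. -/
def SingPhi {n : ℕ} (c : MixedCoeff n) : Set (Fin n → ℂ) :=
  {z | mixedEval c z ≠ 0 ∧
    ∀ j, (starRingEnd ℂ) (mixedEval c z) * wdzbar c j z
        = mixedEval c z * (starRingEnd ℂ) (wdz c j z)}

/-- The ρ-non-regular locus `M(φ)`. -/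
def Mphi {n : ℕ} (c : MixedCoeff n) : Set (Fin n → ℂ) :=
  {z | mixedEval c z ≠ 0 ∧ ∃ lam : ℝ, ∀ j,
    (lam : ℂ) * z j = Complex.I * (starRingEnd ℂ) (mixedEval c z) * wdzbar c j z
      - Complex.I * mixedEval c z * (starRingEnd ℂ) (wdz c j z)}

/-- The Milnor set `M(f)`. -/
def Mf {n : ℕ} (c : MixedCoeff n) : Set (Fin n → ℂ) :=
  {z | ∃ lam : ℝ, ∃ mu : ℂ, mu ≠ 0 ∧ ∀ j,
    (lam : ℂ) * z j = mu * (starRingEnd ℂ) (wdz c j z) + (starRingEnd ℂ) mu * wdzbar c j z}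

/-- The asymptotic ρ-non-regular values `S(φ)` of `f/|f|`. -/
noncomputable def Sphi {n : ℕ} (c : MixedCoeff n) : Set ℂ :=
  {v | ∃ zk : ℕ → (Fin n → ℂ), (∀ k, zk k ∈ Mphi c) ∧
    Tendsto (fun k => ‖zk k‖) atTop atTop ∧
    Tendsto (fun k => phiMap c (zk k)) atTop (nhds v)}

/-- The asymptotic ρ-non-regular values `S(f)`. -/
noncomputable def Sf {n : ℕ} (c : MixedCoeff n) : Set ℂ :=
  {v | ∃ zk : ℕ → (Fin n → ℂ), (∀ k, zk k ∈ Mf c) ∧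
    Tendsto (fun k => ‖zk k‖) atTop atTop ∧
    Tendsto (fun k => mixedEval c (zk k)) atTop (nhds v)}

/-- `v₁(z) = |f(z)|⁻² (f·conj(df) + conj(f)·d̄f)`, the gradient of `log |f|`. -/
noncomputable def vOne {n : ℕ} (c : MixedCoeff n) (z : Fin n → ℂ) : Fin n → ℂ := fun j =>
  ((‖mixedEval c z‖ : ℂ) ^ 2)⁻¹ *
    (mixedEval c z * (starRingEnd ℂ) (wdz c j z)
      + (starRingEnd ℂ) (mixedEval c z) * wdzbar c j z)

/-- `v₂(z) = i|f(z)|⁻² (f·conj(df) − conj(f)·d̄f)`, the gradient of the argument of `f`. -/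
noncomputable def vTwo {n : ℕ} (c : MixedCoeff n) (z : Fin n → ℂ) : Fin n → ℂ := fun j =>
  Complex.I * ((‖mixedEval c z‖ : ℂ) ^ 2)⁻¹ *
    (mixedEval c z * (starRingEnd ℂ) (wdz c j z)
      - (starRingEnd ℂ) (mixedEval c z) * wdzbar c j z)

/-- The Euclidean inner product `Re⟨a, b⟩ = Re Σ a_j conj(b_j)` on `ℂⁿ ≅ ℝ^{2n}`. -/
noncomputable def hermRe {n : ℕ} (a b : Fin n → ℂ) : ℝ :=
  (∑ j, a j * (starRingEnd ℂ) (b j)).re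

/-- `w / |w| ∈ S¹` (with junk value `1` for `w = 0`). -/
noncomputable def unitArg (w : ℂ) : Metric.sphere (0 : ℂ) 1 :=
  if h : w = 0 then ⟨1, by simp⟩
  else ⟨w / (‖w‖ : ℝ), by
    have h1 : (‖w‖ : ℝ) ≠ 0 := by
      simpa using h
    rw [mem_sphere_iff_norm, sub_zero, norm_div, Complex.norm_real, norm_norm, div_self h1]⟩

/-- A locally trivial fibration with fibre `F`. -/
def IsLocTrivFib {E B F : Type*} [TopologicalSpace E] [TopologicalSpace B]
    [TopologicalSpace F] (p : E → B) : Prop :=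
  Continuous p ∧ ∀ b : B, ∃ U : Set B, IsOpen U ∧ b ∈ U ∧
    ∃ h : (p ⁻¹' U) ≃ₜ U × F, ∀ e : (p ⁻¹' U), ((h e).1 : B) = p (e : E)

/-- Radial weighted homogeneity of type `(q₁,…,q_n; m)`. -/
def RadialWH {n : ℕ} (c : MixedCoeff n) (q : Fin n → ℤ) (m : ℕ) : Prop :=
  Finset.univ.gcd q = 1 ∧ 0 < m ∧
    ∀ p ∈ c.support, ∑ j, q j * (p.1 j + p.2 j : ℤ) = (m : ℤ)

/-- A bad face of `supp̄(f)`. -/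
def IsBadFace {n : ℕ} (c : MixedCoeff n) (Δ : Set (Fin n → ℝ)) : Prop :=
  IsExtreme ℝ (suppBar c) Δ ∧
  ∃ a : Fin n → ℝ, (∃ i, a i < 0) ∧ (∃ j, 0 < a j) ∧
    {x : Fin n → ℝ | ∑ k, a k * x k = 0} ∩ suppBar c = Δ

/-- A strictly bad face of `supp̄(f)`. -/
def IsStrictlyBadFace {n : ℕ} (c : MixedCoeff n) (Δ : Set (Fin n → ℝ)) : Prop :=
  IsBadFace c Δ ∧ (0 : Fin n → ℝ) ∈ affineSpan ℝ Δ

theorem oka_example_Sf (c : MixedCoeff 2)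
    (hc : ∀ z : Fin 2 → ℂ, mixedEval c z =
      (1 / 4) * z 0 ^ 2 - (1 / 4) * (starRingEnd ℂ) (z 0) ^ 2
        + z 0 * (starRingEnd ℂ) (z 0)
        - (1 + Complex.I) * (z 0 + z 1) * ((starRingEnd ℂ) (z 0) + (starRingEnd ℂ) (z 1))) :
    Sf c = ∅ := by
  rw [Set.eq_empty_iff_forall_notMem]
  rintro v ⟨zk, -, hn, ht⟩
  -- The map `f` is proper: a bound on `‖f z‖` gives a bound on `‖z‖`.
  have key : ∀ (z : Fin 2 → ℂ) (C : ℝ), ‖mixedEval c z‖ ≤ C → ‖z‖ ≤ 2 * (5 * C + 1) := by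
    intro z C h
    have hC : 0 ≤ C := (norm_nonneg _).trans h
    have h1 := (Complex.abs_re_le_norm (mixedEval c z)).trans h
    have h2 := (Complex.abs_im_le_norm (mixedEval c z)).trans h
    have e1 : (mixedEval c z).re = (z 0).re ^ 2 + (z 0).im ^ 2 - ‖z 0 + z 1‖ ^ 2 := by
      rw [hc, Complex.sq_norm, Complex.normSq_apply]
      simp [pow_two]
      ring
    have e2 : (mixedEval c z).im = (z 0).re * (z 0).im - ‖z 0 + z 1‖ ^ 2 := by
      rw [hc, Complex.sq_norm, Complex.normSq_apply]
      simp [pow_two]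
      ring
    have e3 : ‖z 0‖ ^ 2 = (z 0).re ^ 2 + (z 0).im ^ 2 := by
      rw [Complex.sq_norm, Complex.normSq_apply]
      ring
    rw [e1] at h1
    rw [e2] at h2
    rw [abs_le] at h1 h2
    have b0 : ‖z 0‖ ^ 2 ≤ 4 * C := by
      nlinarith [sq_nonneg ((z 0).re - (z 0).im)]
    have bw : ‖z 0 + z 1‖ ^ 2 ≤ 5 * C := by
      linarith [h1.1]
    have c0 : ‖z 0‖ ≤ 5 * C + 1 := by
      nlinarith [norm_nonneg (z 0), sq_nonneg (‖z 0‖ - 1)]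
    have cw : ‖z 0 + z 1‖ ≤ 5 * C + 1 := by
      nlinarith [norm_nonneg (z 0 + z 1), sq_nonneg (‖z 0 + z 1‖ - 1)]
    have c1 : ‖z 1‖ ≤ ‖z 0 + z 1‖ + ‖z 0‖ := by
      have := norm_sub_le (z 0 + z 1) (z 0)
      simpa using this
    rw [pi_norm_le_iff_of_nonneg (by positivity)]
    intro i
    fin_cases i
    · show ‖z 0‖ ≤ _
      linarith
    · show ‖z 1‖ ≤ _
      linarith
  have hb : ∀ᶠ k in atTop, ‖mixedEval c (zk k)‖ < ‖v‖ + 1 :=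
    ht.norm.eventually_lt_const (by linarith)
  obtain ⟨k, hk1, hk2⟩ :=
    (hb.and (hn.eventually_gt_atTop (2 * (5 * (‖v‖ + 1) + 1)))).exists
  have := key (zk k) _ hk1.le
  linarith
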